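/- arXiv:1104.5472 — 4 statements merged into one kernel-verified Lean document; each statement's English description precedes it below -/
import Mathlib

section
/- Let σ₁, σ₂ be commuting involutions of g with quaternionic decomposition g = g₀₀ ⊕ g₀₁ ⊕ g₁₀ ⊕ g₁₁, and suppose g₁₁ = 0. Set m₀₁ = [g₀₁, g₀₁] and m₁₀ = [g₁₀, g₁₀] (both contained in g₀₀). Then κ(m₀₁, m₁₀) = 0, where κ is the Killing form of g, and m₀₁ ∩ m₁₀ = 0. -/
open LieAlgebra Module

variable (k : Type*) [Field k] [IsAlgClosed k] [CharZero k]
variable (g : Type*) [LieRing g] [LieAlgebra k g] [FiniteDimensional k g]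
  [LieAlgebra.IsSemisimple k g]

/-- The eigenspace of a Lie algebra automorphism `σ` for the eigenvalue `c`. -/
noncomputable def eigSub (σ : g ≃ₗ⁅k⁆ g) (c : k) : Submodule k g :=
  Module.End.eigenspace (σ.toLinearEquiv : g →ₗ[k] g) c

/-- A Lie algebra involution: an automorphism `σ` with `σ ∘ σ = id`. -/
def IsInvolution (σ : g ≃ₗ⁅k⁆ g) : Prop := ∀ x, σ (σ x) = x

/-- Two commuting involutions. -/
def CommutingInvolutions (σ₁ σ₂ : g ≃ₗ⁅k⁆ g) : Prop :=
  IsInvolution k g σ₁ ∧ IsInvolution k g σ₂ ∧ ∀ x, σ₁ (σ₂ x) = σ₂ (σ₁ x)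

/-- The subspace `g_{ij}` of the quaternionic decomposition determined by commuting
involutions `σ₁, σ₂`: here `i, j : Bool` and `false, true` encode the exponents `0, 1`
of the eigenvalues `(-1)^i`, `(-1)^j`. -/
noncomputable def qSpace (σ₁ σ₂ : g ≃ₗ⁅k⁆ g) (i j : Bool) : Submodule k g :=
  eigSub k g σ₁ (if i then -1 else 1) ⊓ eigSub k g σ₂ (if j then -1 else 1)

/-- `x` is a semisimple element of `g`: `ad x` is a semisimple endomorphism. -/
def IsSSElt (x : g) : Prop := Module.End.IsSemisimple (ad k g x)

/-- `x` is a nilpotent element of `g`: `ad x` is a nilpotent endomorphism. -/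
def IsNilpElt (x : g) : Prop := IsNilpotent (ad k g x)

/-- `x` is a regular element of `g`: the dimension of its centralizer equals the rank of `g`,
i.e. the dimension of a Cartan subalgebra of `g`. -/
def IsRegElt (x : g) : Prop :=
  ∃ H : LieSubalgebra k g, H.IsCartanSubalgebra ∧
    Module.finrank k (LinearMap.ker (ad k g x)) = Module.finrank k H

/-- An involution is of maximal rank if its `(-1)`-eigenspace contains a Cartan
subalgebra of `g`. -/
def IsMaxRank (σ : g ≃ₗ⁅k⁆ g) : Prop :=
  ∃ H : LieSubalgebra k g, H.IsCartanSubalgebra ∧ H.toSubmodule ≤ eigSub k g σ (-1)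

/-- The centralizer of an element `x`, as a Lie subalgebra of `g`. -/
def zg (x : g) : LieSubalgebra k g where
  carrier := {y | ⁅x, y⁆ = 0}
  add_mem' := by
    intro a b ha hb
    simp only [Set.mem_setOf_eq] at *
    rw [lie_add, ha, hb, add_zero]
  zero_mem' := by simp
  smul_mem' := by
    intro t a ha
    simp only [Set.mem_setOf_eq] at *
    rw [lie_smul, ha, smul_zero]
  lie_mem' := by
    intro a b ha hb
    simp only [Set.mem_setOf_eq] at *
    rw [leibniz_lie, ha, hb, lie_zero, zero_lie, add_zero]

/-- The fixed-point subalgebra of a Lie algebra automorphism. -/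
def fixSubalgebra (σ : g ≃ₗ⁅k⁆ g) : LieSubalgebra k g where
  carrier := {x | σ x = x}
  add_mem' := by
    intro a b ha hb
    simp only [Set.mem_setOf_eq] at *
    rw [show σ (a + b) = σ a + σ b from σ.toLieHom.map_add a b, ha, hb]
  zero_mem' := by simp only [Set.mem_setOf_eq]; exact σ.toLieHom.map_zero
  smul_mem' := by
    intro t a ha
    simp only [Set.mem_setOf_eq] at *
    rw [show σ (t • a) = t • σ a from σ.toLieHom.map_smul t a, ha]
  lie_mem' := by
    intro a b ha hb
    simp only [Set.mem_setOf_eq] at *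
    rw [LieEquiv.map_lie σ a b, ha, hb]

/-- The exponential of an endomorphism, as a finite sum (which is the genuine exponential
when the endomorphism is nilpotent). -/
noncomputable def expEnd (f : Module.End k g) : Module.End k g :=
  ∑ i ∈ Finset.range (Module.finrank k g + 1), (i.factorial : k)⁻¹ • f ^ i

/-- An automorphism of `g` is inner if it lies in the subgroup of automorphisms generated
by the exponentials `exp (ad x)` with `ad x` nilpotent. -/
noncomputable def IsInnerAut (μ : g ≃ₗ⁅k⁆ g) : Prop :=
  μ.toLinearEquiv ∈ Subgroup.closure
    {e : g ≃ₗ[k] g | ∃ x : g, IsNilpotent (ad k g x) ∧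
      (e : g →ₗ[k] g) = expEnd k g (ad k g x)}

/-- `σ` and `τ` are conjugate by an inner automorphism of `g`. -/
noncomputable def InnerConj (σ τ : g ≃ₗ⁅k⁆ g) : Prop :=
  ∃ φ : g ≃ₗ⁅k⁆ g, IsInnerAut k g φ ∧ ∀ x, τ x = φ (σ (φ.symm x))

/-- A dyad: a pair of distinct commuting involutions that are conjugate by an inner
automorphism of `g`. -/
noncomputable def IsDyad (σ₁ σ₂ : g ≃ₗ⁅k⁆ g) : Prop :=
  IsInvolution k g σ₁ ∧ IsInvolution k g σ₂ ∧ σ₁ ≠ σ₂ ∧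
    (∀ x, σ₁ (σ₂ x) = σ₂ (σ₁ x)) ∧ InnerConj k g σ₁ σ₂

/-- The span of all brackets `⁅x, y⁆` with `x, y` in a subspace `m`. -/
noncomputable def bracketSpan (m : Submodule k g) : Submodule k g :=
  Submodule.span k {z | ∃ x ∈ m, ∃ y ∈ m, z = ⁅x, y⁆}

/-- `c` is a Cartan subspace of a subspace `m ⊆ g`: it consists of pairwise commuting
semisimple elements of `g` and is maximal among such subspaces of `m`. -/
def IsCartanSubspace (m c : Submodule k g) : Prop :=
  c ≤ m ∧ (∀ x ∈ c, IsSSElt k g x) ∧ (∀ x ∈ c, ∀ y ∈ c, ⁅x, y⁆ = 0) ∧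
    ∀ c' : Submodule k g, c' ≤ m → (∀ x ∈ c', IsSSElt k g x) →
      (∀ x ∈ c', ∀ y ∈ c', ⁅x, y⁆ = 0) → c ≤ c' → c' = c

theorem bs_lie_eq_zero {k : Type*} [Field k] {g : Type*} [LieRing g] [LieAlgebra k g]
    (A : Submodule k g) (b : g) (h : ∀ a ∈ A, ⁅a, b⁆ = 0) :
    ∀ x ∈ Submodule.span k {z | ∃ x ∈ A, ∃ y ∈ A, z = ⁅x, y⁆}, ⁅x, b⁆ = 0 := by
  intro x hx
  induction hx using Submodule.span_induction with
  | mem x hx =>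
    obtain ⟨p, hp, q, hq, rfl⟩ := hx
    rw [lie_lie, h p hp, h q hq]; simp
  | zero => simp
  | add x y _ _ h1 h2 => rw [add_lie, h1, h2, add_zero]
  | smul t x _ h1 => rw [smul_lie, h1, smul_zero]

theorem bs_lie_mem {k : Type*} [Field k] {g : Type*} [LieRing g] [LieAlgebra k g]
    (A : Submodule k g) (c : g) (h : ∀ a ∈ A, ⁅c, a⁆ ∈ A) :
    ∀ x ∈ Submodule.span k {z | ∃ x ∈ A, ∃ y ∈ A, z = ⁅x, y⁆},
      ⁅c, x⁆ ∈ Submodule.span k {z | ∃ x ∈ A, ∃ y ∈ A, z = ⁅x, y⁆} := by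
  intro x hx
  induction hx using Submodule.span_induction with
  | mem x hx =>
    obtain ⟨p, hp, q, hq, rfl⟩ := hx
    rw [leibniz_lie]
    exact add_mem (Submodule.subset_span ⟨_, h p hp, _, hq, rfl⟩)
      (Submodule.subset_span ⟨_, hp, _, h q hq, rfl⟩)
  | zero => simp
  | add x y _ _ h1 h2 => rw [lie_add]; exact add_mem h1 h2
  | smul t x _ h1 => rw [lie_smul]; exact Submodule.smul_mem _ _ h1

theorem bs_killing {k : Type*} [Field k] {g : Type*} [LieRing g] [LieAlgebra k g]
    (A : Submodule k g) (w : g) (h : ∀ a ∈ A, ⁅a, w⁆ = 0) :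
    ∀ x ∈ Submodule.span k {z | ∃ x ∈ A, ∃ y ∈ A, z = ⁅x, y⁆}, killingForm k g x w = 0 := by
  intro x hx
  induction hx using Submodule.span_induction with
  | mem x hx =>
    obtain ⟨p, hp, q, hq, rfl⟩ := hx
    rw [LieModule.traceForm_apply_lie_apply, h q hq, map_zero]
  | zero => simp
  | add x y _ _ h1 h2 => rw [map_add, LinearMap.add_apply, h1, h2, add_zero]
  | smul t x _ h1 => rw [map_smul, LinearMap.smul_apply, h1, smul_zero]

theorem mem_qSpace' {k : Type*} [Field k] {g : Type*} [LieRing g] [LieAlgebra k g]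
    (σ₁ σ₂ : g ≃ₗ⁅k⁆ g) (c d : k) (x : g) :
    x ∈ Module.End.eigenspace (σ₁.toLinearEquiv : g →ₗ[k] g) c ⊓
      Module.End.eigenspace (σ₂.toLinearEquiv : g →ₗ[k] g) d ↔
      σ₁ x = c • x ∧ σ₂ x = d • x := by
  rw [Submodule.mem_inf, Module.End.mem_eigenspace_iff, Module.End.mem_eigenspace_iff]
  rfl

/-- If `g₁₁ = 0` in the quaternionic decomposition, then
`κ(m₀₁, m₁₀) = 0` for the Killing form `κ`, and `m₀₁ ∩ m₁₀ = 0`, where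
`m₀₁ = [g₀₁, g₀₁]` and `m₁₀ = [g₁₀, g₁₀]`. -/
theorem killing_orthogonal_of_g11_eq_bot (σ₁ σ₂ : g ≃ₗ⁅k⁆ g)
    (hcomm : CommutingInvolutions k g σ₁ σ₂)
    (h11 : qSpace k g σ₁ σ₂ true true = ⊥) :
    (∀ x ∈ bracketSpan k g (qSpace k g σ₁ σ₂ false true),
      ∀ y ∈ bracketSpan k g (qSpace k g σ₁ σ₂ true false),
        killingForm k g x y = 0) ∧
    bracketSpan k g (qSpace k g σ₁ σ₂ false true) ⊓
      bracketSpan k g (qSpace k g σ₁ σ₂ true false) = ⊥ := by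
  obtain ⟨h1, h2, h12⟩ := hcomm
  unfold IsInvolution at h1 h2
  have mem : ∀ i j x, x ∈ qSpace k g σ₁ σ₂ i j ↔
      σ₁ x = (if i then (-1 : k) else 1) • x ∧ σ₂ x = (if j then (-1 : k) else 1) • x :=
    fun i j x => mem_qSpace' σ₁ σ₂ _ _ x
  have hAB : ∀ a ∈ qSpace k g σ₁ σ₂ false true, ∀ b ∈ qSpace k g σ₁ σ₂ true false,
      ⁅a, b⁆ = 0 := by
    intro a ha b hb
    rw [mem] at ha hb
    have : ⁅a, b⁆ ∈ qSpace k g σ₁ σ₂ true true := by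
      rw [mem, LieEquiv.map_lie, LieEquiv.map_lie, ha.1, ha.2, hb.1, hb.2]
      simp
    rw [h11] at this
    simpa using this
  have hC : ∀ c ∈ qSpace k g σ₁ σ₂ false false, ∀ i j, ∀ a ∈ qSpace k g σ₁ σ₂ i j,
      ⁅c, a⁆ ∈ qSpace k g σ₁ σ₂ i j := by
    intro c hc i j a ha
    rw [mem] at ha hc ⊢
    rw [LieEquiv.map_lie, LieEquiv.map_lie, ha.1, ha.2, hc.1, hc.2]
    cases i <;> cases j <;> simp
  have hBm : ∀ b ∈ qSpace k g σ₁ σ₂ true false,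
      ∀ x ∈ bracketSpan k g (qSpace k g σ₁ σ₂ false true), ⁅x, b⁆ = 0 :=
    fun b hb => bs_lie_eq_zero _ b (fun a ha => hAB a ha b hb)
  have hAm : ∀ a ∈ qSpace k g σ₁ σ₂ false true,
      ∀ y ∈ bracketSpan k g (qSpace k g σ₁ σ₂ true false), ⁅y, a⁆ = 0 :=
    fun a ha => bs_lie_eq_zero _ a
      (fun b hb => by rw [← lie_skew, hAB a ha b hb, neg_zero])
  have hmm : ∀ x ∈ bracketSpan k g (qSpace k g σ₁ σ₂ false true),
      ∀ y ∈ bracketSpan k g (qSpace k g σ₁ σ₂ true false), ⁅x, y⁆ = 0 :=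
    fun x hx y hy => bs_lie_eq_zero _ y
      (fun a ha => by rw [← lie_skew, hAm a ha y hy, neg_zero]) x hx
  refine ⟨fun x hx y hy => bs_killing _ y
      (fun a ha => by rw [← lie_skew, hAm a ha y hy, neg_zero]) x hx, ?_⟩
  have hdec : ∀ x : g, ∃ c ∈ qSpace k g σ₁ σ₂ false false, ∃ a ∈ qSpace k g σ₁ σ₂ false true,
      ∃ b ∈ qSpace k g σ₁ σ₂ true false, x = c + a + b := by
    intro x
    have s1 : ∀ u v, σ₁ (u + v) = σ₁ u + σ₁ v := fun u v => σ₁.toLieHom.map_add u v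
    have s2 : ∀ u v, σ₂ (u + v) = σ₂ u + σ₂ v := fun u v => σ₂.toLieHom.map_add u v
    have n1 : ∀ u v, σ₁ (u - v) = σ₁ u - σ₁ v := fun u v => σ₁.toLieHom.map_sub u v
    have n2 : ∀ u v, σ₂ (u - v) = σ₂ u - σ₂ v := fun u v => σ₂.toLieHom.map_sub u v
    have h0 : x - σ₁ x - σ₂ x + σ₁ (σ₂ x) = 0 := by
      have : x - σ₁ x - σ₂ x + σ₁ (σ₂ x) ∈ qSpace k g σ₁ σ₂ true true := by
        rw [mem]
        simp only [s1, s2, n1, n2, h1, h2, ← h12, if_true, neg_smul, one_smul]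
        constructor <;> abel
      rw [h11] at this
      simpa using this
    refine ⟨(4⁻¹ : k) • (x + σ₁ x + σ₂ x + σ₁ (σ₂ x)), Submodule.smul_mem _ _ ?_,
      (4⁻¹ : k) • (x + σ₁ x - σ₂ x - σ₁ (σ₂ x)), Submodule.smul_mem _ _ ?_,
      (4⁻¹ : k) • (x - σ₁ x + σ₂ x - σ₁ (σ₂ x)), Submodule.smul_mem _ _ ?_, ?_⟩
    · rw [mem]
      simp only [s1, s2, n1, n2, h1, h2, ← h12, if_true, neg_smul, one_smul]
      constructor <;> simp <;> abel
    · rw [mem]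
      simp only [s1, s2, n1, n2, h1, h2, ← h12, if_true, neg_smul, one_smul]
      constructor <;> simp <;> abel
    · rw [mem]
      simp only [s1, s2, n1, n2, h1, h2, ← h12, if_true, neg_smul, one_smul]
      constructor <;> simp <;> abel
    · have h4 : (4 : k) ≠ 0 := by norm_num
      have : σ₁ (σ₂ x) = σ₁ x + σ₂ x - x := by
        rw [← sub_eq_zero, ← h0]; abel
      rw [this]
      match_scalars <;> field_simp <;> ring
  let I : LieIdeal k g :=
    { bracketSpan k g (qSpace k g σ₁ σ₂ false true) ⊓
        bracketSpan k g (qSpace k g σ₁ σ₂ true false) with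
      lie_mem := by
        rintro x m ⟨hm1, hm2⟩
        obtain ⟨c, hc, a, ha, b, hb, rfl⟩ := hdec x
        have e1 : ⁅a, m⁆ = 0 := by rw [← lie_skew, hAm a ha m hm2, neg_zero]
        have e2 : ⁅b, m⁆ = 0 := by rw [← lie_skew, hBm b hb m hm1, neg_zero]
        rw [add_lie, add_lie, e1, e2, add_zero, add_zero]
        exact ⟨bs_lie_mem _ c (hC c hc false true) m hm1,
          bs_lie_mem _ c (hC c hc true false) m hm2⟩ }
  have hI : IsLieAbelian I := by
    refine ⟨fun x y => ?_⟩
    apply Subtype.ext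
    exact hmm x.1 x.2.1 y.1 y.2.2
  have hbot : I = ⊥ := HasTrivialRadical.eq_bot_of_isSolvable I
  exact congrArg LieSubmodule.toSubmodule hbot
end

section
/- Let σ₁, σ₂ be commuting involutions of g with quaternionic decomposition g = g₀₀ ⊕ g₀₁ ⊕ g₁₀ ⊕ g₁₁, and suppose g₁₁ = 0. Set m₀₁ = [g₀₁, g₀₁] and m₁₀ = [g₁₀, g₁₀] (both contained in g₀₀). Then the subspaces m₁₀ ⊕ g₁₀ and m₀₁ ⊕ g₀₁ are ideals of the Lie algebra g, and their intersection is zero. -/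
open LieAlgebra Module

variable (k : Type*) [Field k] [IsAlgClosed k] [CharZero k]
variable (g : Type*) [LieRing g] [LieAlgebra k g] [FiniteDimensional k g]
  [LieAlgebra.IsSemisimple k g]

theorem aux_mem_q (σ₁ σ₂ : g ≃ₗ⁅k⁆ g) (i j : Bool) (x : g) :
    x ∈ qSpace k g σ₁ σ₂ i j ↔
      σ₁ x = (if i then (-1 : k) else 1) • x ∧ σ₂ x = (if j then (-1 : k) else 1) • x := by
  unfold qSpace eigSub
  rw [Submodule.mem_inf, Module.End.mem_eigenspace_iff, Module.End.mem_eigenspace_iff]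
  rfl

theorem aux_bs_ind (A P : Submodule k g) (h : ∀ x ∈ A, ∀ y ∈ A, ⁅x, y⁆ ∈ P) :
    bracketSpan k g A ≤ P := by
  unfold bracketSpan
  rw [Submodule.span_le]
  rintro z ⟨x, hx, y, hy, rfl⟩
  exact h x hx y hy

theorem aux_bs_mem (A : Submodule k g) {x y : g} (hx : x ∈ A) (hy : y ∈ A) :
    ⁅x, y⁆ ∈ bracketSpan k g A :=
  Submodule.subset_span ⟨x, hx, y, hy, rfl⟩

theorem aux_ideal (A B C : Submodule k g)
    (hdec : ∀ y : g, ∃ a ∈ A, ∃ b ∈ B, ∃ c ∈ C, y = a + b + c)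
    (hAB : ∀ b ∈ B, ∀ a ∈ A, ⁅b, a⁆ = 0)
    (hCA : ∀ c ∈ C, ∀ a ∈ A, ⁅c, a⁆ ∈ A)
    (hAA : ∀ a ∈ A, ∀ a' ∈ A, ⁅a, a'⁆ ∈ C) :
    ∀ y : g, ∀ x ∈ bracketSpan k g A ⊔ A, ⁅y, x⁆ ∈ bracketSpan k g A ⊔ A := by
  intro y
  suffices h : bracketSpan k g A ⊔ A ≤
      (bracketSpan k g A ⊔ A).comap (ad k g y : g →ₗ[k] g) from fun x hx => h hx
  have hl : bracketSpan k g A ≤ bracketSpan k g A ⊔ A := le_sup_left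
  have hr : A ≤ bracketSpan k g A ⊔ A := le_sup_right
  obtain ⟨a, ha, b, hb, c, hc, rfl⟩ := hdec y
  refine sup_le (aux_bs_ind k g A _ ?_) ?_
  · intro u hu v hv
    rw [Submodule.mem_comap, ad_apply, add_lie, add_lie]
    refine add_mem (add_mem ?_ ?_) ?_
    · rw [← lie_skew]
      exact neg_mem (hr (hCA _ (hAA u hu v hv) a ha))
    · rw [leibniz_lie, hAB b hb u hu, hAB b hb v hv]
      simp
    · rw [leibniz_lie]
      exact hl (add_mem (aux_bs_mem k g A (hCA c hc u hu) hv)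
        (aux_bs_mem k g A hu (hCA c hc v hv)))
  · intro u hu
    rw [Submodule.mem_comap, ad_apply, add_lie, add_lie, hAB b hb u hu, add_zero]
    exact add_mem (hl (aux_bs_mem k g A ha hu)) (hr (hCA c hc u hu))

theorem aux_comm_right (A : Submodule k g) (b : g) (h : ∀ a ∈ A, ⁅b, a⁆ = 0) :
    ∀ x ∈ bracketSpan k g A ⊔ A, ⁅b, x⁆ = 0 := by
  suffices hh : bracketSpan k g A ⊔ A ≤ LinearMap.ker (ad k g b : g →ₗ[k] g) from
    fun x hx => hh hx
  refine sup_le (aux_bs_ind k g A _ ?_) ?_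
  · intro u hu v hv
    rw [LinearMap.mem_ker, ad_apply, leibniz_lie, h u hu, h v hv]
    simp
  · intro u hu
    exact h u hu

theorem aux_dec (σ₁ σ₂ : g ≃ₗ⁅k⁆ g)
    (hcomm : CommutingInvolutions k g σ₁ σ₂)
    (h11 : qSpace k g σ₁ σ₂ true true = ⊥) (y : g) :
    ∃ a ∈ qSpace k g σ₁ σ₂ true false, ∃ b ∈ qSpace k g σ₁ σ₂ false true,
      ∃ c ∈ qSpace k g σ₁ σ₂ false false, y = a + b + c := by
  obtain ⟨h1, h2, h12⟩ := hcomm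
  have e : y - σ₁ y - σ₂ y + σ₁ (σ₂ y) = 0 := by
    rw [← Submodule.mem_bot k, ← h11, aux_mem_q]
    constructor
    · simp only [map_add, map_sub, h1 _, if_true, neg_smul, one_smul]
      abel
    · simp only [map_add, map_sub, h2 _, ← h12, if_true, neg_smul, one_smul]
      simp only [h12, h2 _]
      abel
  have h4 : (4 : k) ≠ 0 := by norm_num
  refine ⟨(4 : k)⁻¹ • (y - σ₁ y + σ₂ y - σ₁ (σ₂ y)), Submodule.smul_mem _ _ ?_,
    (4 : k)⁻¹ • (y + σ₁ y - σ₂ y - σ₁ (σ₂ y)), Submodule.smul_mem _ _ ?_,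
    (4 : k)⁻¹ • (y + σ₁ y + σ₂ y + σ₁ (σ₂ y)), Submodule.smul_mem _ _ ?_, ?_⟩
  · rw [aux_mem_q]
    constructor
    · simp only [map_add, map_sub, h1 _, if_true, neg_smul, one_smul]
      abel
    · simp only [map_add, map_sub, h12, h2 _, Bool.false_eq_true, if_false, one_smul]
      abel
  · rw [aux_mem_q]
    constructor
    · simp only [map_add, map_sub, h1 _, Bool.false_eq_true, if_false, one_smul]
      abel
    · simp only [map_add, map_sub, h12, h2 _, if_true, neg_smul, one_smul]
      abel
  · rw [aux_mem_q]
    constructor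
    · simp only [map_add, map_sub, h1 _, Bool.false_eq_true, if_false, one_smul]
      abel
    · simp only [map_add, map_sub, h12, h2 _, Bool.false_eq_true, if_false, one_smul]
      abel
  · have e' : σ₁ (σ₂ y) = σ₁ y + σ₂ y - y := by
      rw [← sub_eq_zero, ← e]
      abel
    rw [← smul_add, ← smul_add, e', eq_inv_smul_iff₀ h4]
    module

theorem aux_grade (σ₁ σ₂ : g ≃ₗ⁅k⁆ g) (i j i' j' : Bool) (x y : g)
    (hx : x ∈ qSpace k g σ₁ σ₂ i j) (hy : y ∈ qSpace k g σ₁ σ₂ i' j') :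
    ⁅x, y⁆ ∈ qSpace k g σ₁ σ₂ (xor i i') (xor j j') := by
  rw [aux_mem_q] at *
  have key : ∀ p q : Bool, ((if p then (-1 : k) else 1) * (if q then (-1 : k) else 1)) =
      (if (xor p q) then (-1 : k) else 1) := by
    intro p q
    cases p <;> cases q <;> simp
  rw [LieEquiv.map_lie, LieEquiv.map_lie, hx.1, hx.2, hy.1, hy.2, smul_lie, smul_lie, lie_smul,
    lie_smul, smul_smul, smul_smul, key, key]
  exact ⟨rfl, rfl⟩

theorem aux_inf (P Q : Submodule k g) (I1 : ∀ y : g, ∀ x ∈ P, ⁅y, x⁆ ∈ P)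
    (I2 : ∀ y : g, ∀ x ∈ Q, ⁅y, x⁆ ∈ Q) (hcom : ∀ x ∈ P, ∀ y ∈ Q, ⁅x, y⁆ = 0) :
    P ⊓ Q = ⊥ := by
  let J : LieIdeal k g :=
    { P ⊓ Q with lie_mem := fun {y x} hx => ⟨I1 y x hx.1, I2 y x hx.2⟩ }
  have hJ : IsLieAbelian J :=
    ⟨fun x y => Subtype.ext (hcom x.1 x.2.1 y.1 y.2.2)⟩
  have hbot : J = ⊥ :=
    (LieAlgebra.hasTrivialRadical_iff_no_abelian_ideals k g).1 inferInstance J hJ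
  exact congrArg LieSubmodule.toSubmodule hbot

/-- If `g₁₁ = 0` in the quaternionic decomposition, then
`m₁₀ ⊕ g₁₀` and `m₀₁ ⊕ g₀₁` are ideals of `g` with zero intersection,
where `m₀₁ = [g₀₁, g₀₁]` and `m₁₀ = [g₁₀, g₁₀]`. -/
theorem disjoint_ideals_of_g11_eq_bot (σ₁ σ₂ : g ≃ₗ⁅k⁆ g)
    (hcomm : CommutingInvolutions k g σ₁ σ₂)
    (h11 : qSpace k g σ₁ σ₂ true true = ⊥) :
    (∀ y : g, ∀ x ∈ bracketSpan k g (qSpace k g σ₁ σ₂ true false) ⊔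
        qSpace k g σ₁ σ₂ true false,
      ⁅y, x⁆ ∈ bracketSpan k g (qSpace k g σ₁ σ₂ true false) ⊔
        qSpace k g σ₁ σ₂ true false) ∧
    (∀ y : g, ∀ x ∈ bracketSpan k g (qSpace k g σ₁ σ₂ false true) ⊔
        qSpace k g σ₁ σ₂ false true,
      ⁅y, x⁆ ∈ bracketSpan k g (qSpace k g σ₁ σ₂ false true) ⊔
        qSpace k g σ₁ σ₂ false true) ∧
    (bracketSpan k g (qSpace k g σ₁ σ₂ true false) ⊔ qSpace k g σ₁ σ₂ true false) ⊓
      (bracketSpan k g (qSpace k g σ₁ σ₂ false true) ⊔ qSpace k g σ₁ σ₂ false true) = ⊥ := by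
  have hg := aux_grade k g σ₁ σ₂
  have hd := aux_dec k g σ₁ σ₂ hcomm h11
  have hBA : ∀ b ∈ qSpace k g σ₁ σ₂ false true, ∀ a ∈ qSpace k g σ₁ σ₂ true false,
      ⁅b, a⁆ = 0 := by
    intro b hb a ha
    have h : ⁅b, a⁆ ∈ qSpace k g σ₁ σ₂ true true := hg false true true false b a hb ha
    rw [h11] at h
    exact (Submodule.mem_bot k).1 h
  have hAB : ∀ a ∈ qSpace k g σ₁ σ₂ true false, ∀ b ∈ qSpace k g σ₁ σ₂ false true,
      ⁅a, b⁆ = 0 := by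
    intro a ha b hb
    rw [← lie_skew, hBA b hb a ha, neg_zero]
  have I1 := aux_ideal k g (qSpace k g σ₁ σ₂ true false) (qSpace k g σ₁ σ₂ false true)
    (qSpace k g σ₁ σ₂ false false) hd hBA
    (fun c hc a ha => hg false false true false c a hc ha)
    (fun a ha b hb => hg true false true false a b ha hb)
  have I2 := aux_ideal k g (qSpace k g σ₁ σ₂ false true) (qSpace k g σ₁ σ₂ true false)
    (qSpace k g σ₁ σ₂ false false)
    (fun y => by
      obtain ⟨a, ha, b, hb, c, hc, h⟩ := hd y
      exact ⟨b, hb, a, ha, c, hc, by rw [h, add_comm a b]⟩) hAB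
    (fun c hc a ha => hg false false false true c a hc ha)
    (fun a ha b hb => hg false true false true a b ha hb)
  refine ⟨I1, I2, ?_⟩
  have hcom : ∀ x ∈ bracketSpan k g (qSpace k g σ₁ σ₂ true false) ⊔ qSpace k g σ₁ σ₂ true false,
      ∀ y ∈ bracketSpan k g (qSpace k g σ₁ σ₂ false true) ⊔ qSpace k g σ₁ σ₂ false true,
      ⁅x, y⁆ = 0 := by
    intro x hx
    apply aux_comm_right
    intro b hb
    rw [← lie_skew, aux_comm_right k g _ b (hBA b hb) x hx, neg_zero]
  exact aux_inf k g _ _ I1 I2 hcom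
end

section
/- Let σ₁, σ₂ be commuting involutions of g with quaternionic decomposition g = g₀₀ ⊕ g₀₁ ⊕ g₁₀ ⊕ g₁₁. Suppose that σ₁ ≠ id, that the fixed-point subalgebra g^{σ₁} = g₀₀ ⊕ g₀₁ contains no nonzero ideal of g, and that g₁₁ = 0. Then g₀₁ = 0. -/
open LieAlgebra Module

variable (k : Type*) [Field k] [IsAlgClosed k] [CharZero k]
variable (g : Type*) [LieRing g] [LieAlgebra k g] [FiniteDimensional k g]
  [LieAlgebra.IsSemisimple k g]

/-- Suppose `σ₁ ≠ id`, the fixed-point subalgebra `g^{σ₁} = g₀₀ ⊕ g₀₁`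
contains no nonzero ideal of `g`, and `g₁₁ = 0`. Then `g₀₁ = 0`. -/
theorem g01_eq_bot_of_no_proper_ideal (σ₁ σ₂ : g ≃ₗ⁅k⁆ g)
    (hcomm : CommutingInvolutions k g σ₁ σ₂)
    (hne : ∃ x : g, σ₁ x ≠ x)
    (hnoideal : ∀ I : LieIdeal k g,
      I.toSubmodule ≤ qSpace k g σ₁ σ₂ false false ⊔ qSpace k g σ₁ σ₂ false true → I = ⊥)
    (h11 : qSpace k g σ₁ σ₂ true true = ⊥) :
    qSpace k g σ₁ σ₂ false true = ⊥ := by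
  obtain ⟨h1, h2, h12⟩ := hcomm
  have mem : ∀ (σ : g ≃ₗ⁅k⁆ g) (c : k) (x : g), x ∈ eigSub k g σ c ↔ σ x = c • x := by
    intro σ c x
    exact Module.End.mem_eigenspace_iff
  have z11 : ∀ x : g, σ₁ x = -x → σ₂ x = -x → x = 0 := by
    intro x hx hy
    have : x ∈ qSpace k g σ₁ σ₂ true true :=
      ⟨(mem _ _ _).2 (by simpa using hx), (mem _ _ _).2 (by simpa using hy)⟩
    rw [h11] at this
    simpa using this
  have dbl : ∀ a : g, a = -a → a = 0 := by
    intro a ha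
    have h : (2 : k) • a = 0 := by
      rw [two_smul]
      nth_rewrite 2 [ha]
      exact add_neg_cancel a
    exact (smul_eq_zero.1 h).resolve_left two_ne_zero
  have key : ∀ x : g, (∀ y : g, σ₁ y = -y → ⁅x, y⁆ = 0) → ∀ y : g, ⁅x, y⁆ = ⁅x, σ₁ y⁆ := by
    intro x hx y
    have := hx (y - σ₁ y) (by rw [map_sub, h1]; abel)
    rw [lie_sub] at this
    exact sub_eq_zero.1 this
  let J : LieIdeal k g :=
    { carrier := {x | σ₁ x = x ∧ ∀ y : g, σ₁ y = -y → ⁅x, y⁆ = 0}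
      add_mem' := by
        rintro a b ⟨ha, ha'⟩ ⟨hb, hb'⟩
        exact ⟨by rw [map_add, ha, hb], fun y hy => by rw [add_lie, ha' y hy, hb' y hy, add_zero]⟩
      zero_mem' := ⟨map_zero _, fun y _ => zero_lie y⟩
      smul_mem' := by
        rintro t a ⟨ha, ha'⟩
        exact ⟨by rw [map_smul, ha], fun y hy => by rw [smul_lie, ha' y hy, smul_zero]⟩
      lie_mem := by
        rintro y x ⟨hx, hx'⟩
        refine ⟨?_, fun z hz => ?_⟩
        · rw [LieEquiv.map_lie, hx, ← lie_skew, ← key x hx' y, lie_skew]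
        · have A : ∀ w : g, ⁅x, ⁅w, z⁆⁆ = ⁅⁅x, w⁆, z⁆ := by
            intro w
            rw [leibniz_lie, hx' z hz, lie_zero, add_zero]
          have B : ⁅x, ⁅y, z⁆⁆ = -⁅x, ⁅y, z⁆⁆ := by
            conv_lhs => rw [key x hx', LieEquiv.map_lie, hz, lie_neg, lie_neg, A, ← key x hx' y, ← A]
          have C := dbl _ B
          rw [A] at C
          rw [← lie_skew y x, neg_lie, C, neg_zero] }
  have hJ : J = ⊥ := by
    apply hnoideal
    rintro x ⟨hx, -⟩
    have e : x = (2 : k)⁻¹ • (x + σ₂ x) + (2 : k)⁻¹ • (x - σ₂ x) := by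
      rw [← smul_add, add_add_sub_cancel, ← two_smul k x, smul_smul,
        inv_mul_cancel₀ two_ne_zero, one_smul]
    rw [e]
    refine Submodule.add_mem_sup (Submodule.smul_mem _ _ ⟨(mem _ _ _).2 ?_, (mem _ _ _).2 ?_⟩)
      (Submodule.smul_mem _ _ ⟨(mem _ _ _).2 ?_, (mem _ _ _).2 ?_⟩)
    · simp [h12, hx]
    · simp [h2 x, add_comm]
    · simp [h12, hx]
    · simp [h2 x]
  rw [eq_bot_iff]
  rintro x ⟨hx1, hx2⟩
  have hx1 : σ₁ x = x := by simpa using (mem _ _ _).1 hx1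
  have hx2 : σ₂ x = -x := by simpa using (mem _ _ _).1 hx2
  have hxJ : x ∈ J := by
    refine ⟨hx1, fun y hy => ?_⟩
    have hy2 : y - σ₂ y = 0 := z11 _ (by rw [map_sub, h12, hy, map_neg]; abel)
      (by rw [map_sub, h2]; abel)
    have hy2 : σ₂ y = y := (sub_eq_zero.1 hy2).symm
    exact z11 _ (by rw [LieEquiv.map_lie, hx1, hy, lie_neg])
      (by rw [LieEquiv.map_lie, hx2, hy2, neg_lie])
  rw [hJ] at hxJ
  simpa using hxJ
end

section
/- Let σ₁, σ₂ be commuting involutions of g with quaternionic decomposition g = g₀₀ ⊕ g₀₁ ⊕ g₁₀ ⊕ g₁₁, and suppose σ₁ is of maximal rank. Then any Cartan subspace of g₁₁ is also a Cartan subspace of g₀₁ ⊕ g₁₁ (the (−1)-eigenspace of σ₂). -/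
open LieAlgebra Module

variable (k : Type*) [Field k] [IsAlgClosed k] [CharZero k]
variable (g : Type*) [LieRing g] [LieAlgebra k g] [FiniteDimensional k g]
  [LieAlgebra.IsSemisimple k g]

section Aux
set_option linter.unusedSectionVars false
variable {k g}

theorem adk_inj {x : g} (h : ad k g x = 0) : x = 0 :=
  (LieDerivation.IsKilling.ad_apply_eq_zero_iff (R := k) (L := g) x).mp (by
    ext y
    have := LinearMap.congr_fun h y
    simpa using this)

theorem ad_comm {x y : g} (h : ⁅x, y⁆ = 0) : Commute (ad k g x) (ad k g y) := by
  change _ * _ = _ * _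
  ext z
  simp only [Module.End.mul_apply, ad_apply]
  rw [leibniz_lie, h, zero_lie, zero_add]

theorem comm_of_ad {x y : g} (h : Commute (ad k g x) (ad k g y)) : ⁅x, y⁆ = 0 := by
  apply adk_inj (k := k)
  ext z
  have := LinearMap.congr_fun (h : _ * _ = _ * _) z
  simp only [Module.End.mul_apply, ad_apply] at this
  simp [lie_lie, this]

theorem jordan_aux (x : g) : ∃ s n : g, x = s + n ∧ (ad k g s).IsSemisimple ∧
    IsNilpotent (ad k g n) ∧ ad k g s ∈ Algebra.adjoin k {ad k g x} := by
  obtain ⟨N, -, S, hS₀, hN, hS, hSN⟩ := (ad k g x).exists_isNilpotent_isSemisimple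
  have hc : Commute (ad k g x) S := Algebra.commute_of_mem_adjoin_self hS₀
  have hN' : IsNilpotent (ad k g x - S) := by rwa [eq_sub_of_add_eq hSN.symm] at hN
  have aux {μ : k} {y : g} (hy : y ∈ (ad k g x).maxGenEigenspace μ) : S y = μ • y :=
    Module.End.apply_eq_of_mem_of_comm_of_isFinitelySemisimple_of_isNil hy hc
      hS.isFinitelySemisimple hN'
  have h_der0 (y z : g) (α β : k) (hy : y ∈ (ad k g x).maxGenEigenspace α)
      (hz : z ∈ (ad k g x).maxGenEigenspace β) : S ⁅y, z⁆ = ⁅S y, z⁆ + ⁅y, S z⁆ := by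
    have hyz : ⁅y, z⁆ ∈ (ad k g x).maxGenEigenspace (α + β) :=
      LieModule.lie_mem_maxGenEigenspace_toEnd hy hz
    rw [aux hy, aux hz, aux hyz, smul_lie, lie_smul, ← add_smul]
  have h_der (y z : g) : S ⁅y, z⁆ = ⁅S y, z⁆ + ⁅y, S z⁆ := by
    have hy : y ∈ ⨆ α : k, (ad k g x).maxGenEigenspace α := by
      simp [Module.End.iSup_maxGenEigenspace_eq_top]
    have hz : z ∈ ⨆ α : k, (ad k g x).maxGenEigenspace α := by
      simp [Module.End.iSup_maxGenEigenspace_eq_top]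
    induction hy using Submodule.iSup_induction' with
    | mem α y hy =>
      induction hz using Submodule.iSup_induction' with
      | mem β z hz => exact h_der0 y z α β hy hz
      | zero => simp
      | add _ _ _ _ h h' => simp only [lie_add, map_add, h, h']; abel
    | zero => simp
    | add _ _ _ _ h h' => simp only [add_lie, map_add, h, h']; abel
  have h_der' : ∀ y z : g, S ⁅y, z⁆ = ⁅y, S z⁆ - ⁅z, S y⁆ := by
    intro y z
    rw [h_der, ← lie_skew (S y) z]; abel
  let S' : LieDerivation k g g := ⟨S, h_der'⟩
  obtain ⟨s, hs⟩ := LieDerivation.IsKilling.exists_eq_ad S'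
  have hs' : ad k g s = S := by
    ext y
    have := congrArg (fun D : LieDerivation k g g => D y) hs
    simpa [S'] using this
  refine ⟨s, x - s, by abel, hs' ▸ hS, ?_, hs' ▸ hS₀⟩
  rw [map_sub, hs']; exact hN'

theorem gen_aux (c : Submodule k g) (hss : ∀ x ∈ c, IsSSElt k g x)
    (hcm : ∀ x ∈ c, ∀ y ∈ c, ⁅x, y⁆ = 0) :
    ∃ x ∈ c, ∀ y ∈ c, ad k g y ∈ Algebra.adjoin k {ad k g x} := by
  classical
  let f : c → Module.End k g := fun y => ad k g y
  have hf (a b : c) : Commute (f a) (f b) := by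
    exact ad_comm (hcm a a.2 b b.2)
  let W : (c → k) → Submodule k g := fun χ => ⨅ i, (f i).maxGenEigenspace (χ i)
  have hind : iSupIndep W :=
    Module.End.independent_iInf_maxGenEigenspace_of_forall_mapsTo f
      (fun i j φ => Module.End.mapsTo_maxGenEigenspace_of_comm (hf j i) φ)
  have htop : ⨆ χ, W χ = ⊤ :=
    Module.End.iSup_iInf_maxGenEigenspace_eq_top_of_iSup_maxGenEigenspace_eq_top_of_commute f
      (fun i j _ => hf i j) (fun i => Module.End.iSup_maxGenEigenspace_eq_top _)
  have hW {χ : c → k} {v : g} (hv : v ∈ W χ) (y : c) : f y v = χ y • v := by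
    have h1 : v ∈ (f y).maxGenEigenspace (χ y) := (Submodule.mem_iInf _).mp hv y
    rw [(hss y y.2 : (f y).IsSemisimple).isFinitelySemisimple.maxGenEigenspace_eq_eigenspace] at h1
    exact Module.End.mem_eigenspace_iff.mp h1
  have hfin : {χ | W χ ≠ ⊥}.Finite := WellFoundedGT.finite_ne_bot_of_iSupIndep hind
  let X := {χ // W χ ≠ ⊥}
  have : Finite X := hfin
  have hlin (χ : X) : ∃ F : Module.Dual k c, ∀ y, F y = χ.1 y := by
    obtain ⟨v, hv, hv0⟩ := (Submodule.ne_bot_iff _).mp χ.2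
    refine ⟨⟨⟨χ.1, ?_⟩, ?_⟩, fun _ => rfl⟩
    · intro a b
      apply smul_left_injective k hv0
      simp only [add_smul]
      rw [← hW hv, ← hW hv, ← hW hv]; simp [f]
    · intro t b
      apply smul_left_injective k hv0
      simp only [RingHom.id_apply, smul_eq_mul, mul_smul]
      rw [← hW hv, ← hW hv]; simp [f]
  choose F hF using hlin
  obtain ⟨x, hx⟩ := Module.Dual.exists_forall_ne_zero_of_forall_exists
    (fun p : {p : X × X // p.1 ≠ p.2} => F p.1.1 - F p.1.2) (by
      rintro ⟨⟨a, b⟩, hab⟩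
      by_contra! hcon
      apply hab
      apply Subtype.ext
      funext y
      have := hcon y
      simpa [hF, sub_eq_zero] using this)
  have hinj : Function.Injective (fun χ : X => χ.1 x) := by
    intro a b hab
    by_contra hne
    apply hx ⟨⟨a, b⟩, hne⟩
    simpa [hF, sub_eq_zero] using hab
  refine ⟨x, x.2, fun y hy => ?_⟩
  have := Fintype.ofFinite X
  let q := Lagrange.interpolate Finset.univ (fun χ : X => χ.1 x) (fun χ : X => χ.1 ⟨y, hy⟩)
  have hq (χ : X) : q.eval (χ.1 x) = χ.1 ⟨y, hy⟩ :=
    Lagrange.eval_interpolate_at_node _ hinj.injOn (Finset.mem_univ χ)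
  rw [Algebra.adjoin_singleton_eq_range_aeval]
  refine ⟨q, ?_⟩
  ext v
  have hv : v ∈ ⨆ χ, W χ := by rw [htop]; trivial
  induction hv using Submodule.iSup_induction' with
  | mem χ v hv =>
    by_cases hv0 : v = 0
    · simp [hv0]
    have hχ : W χ ≠ ⊥ := (Submodule.ne_bot_iff _).mpr ⟨v, hv, hv0⟩
    have e : (f x).HasEigenvector (χ x) v := ⟨Module.End.mem_eigenspace_iff.mpr (hW hv x), hv0⟩
    have h1 := Module.End.aeval_apply_of_hasEigenvector (p := q) e
    have h2 := hq ⟨χ, hχ⟩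
    have h3 := hW hv ⟨y, hy⟩
    simp only [f] at h1 h3
    simp only at h2
    rw [h2] at h1
    exact h1.trans h3.symm
  | zero => simp
  | add _ _ _ _ h h' => rw [map_add, map_add, h, h']

theorem disj_aux {x : g} (h : IsSSElt k g x) {u : g} (hu : ⁅x, ⁅x, u⁆⁆ = 0) : ⁅x, u⁆ = 0 := by
  have h1 : u ∈ (ad k g x).maxGenEigenspace 0 := by
    rw [Module.End.mem_maxGenEigenspace]
    exact ⟨2, by simp [pow_two, hu]⟩
  rw [(h : (ad k g x).IsSemisimple).isFinitelySemisimple.maxGenEigenspace_eq_eigenspace] at h1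
  simpa using Module.End.mem_eigenspace_iff.mp h1

theorem split_aux {x : g} (h : IsSSElt k g x) (v : g) : ∃ w u : g, ⁅x, w⁆ = 0 ∧ v = w + ⁅x, u⁆ := by
  have hd : Disjoint (LinearMap.ker (ad k g x)) (LinearMap.range (ad k g x)) := by
    rw [Submodule.disjoint_def]
    rintro _ h1 ⟨u, rfl⟩
    exact disj_aux h (by simpa using h1)
  have ht : LinearMap.ker (ad k g x) ⊔ LinearMap.range (ad k g x) = ⊤ :=
    Submodule.eq_top_of_disjoint _ _ (by
      have := LinearMap.finrank_range_add_finrank_ker (ad k g x); omega) hd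
  obtain ⟨w, hw, _, ⟨u, rfl⟩, h2⟩ := Submodule.mem_sup.mp (ht ▸ Submodule.mem_top : v ∈ _)
  exact ⟨w, u, by simpa using hw, by simpa using h2.symm⟩

theorem mem_eig {σ : g ≃ₗ⁅k⁆ g} {c : k} {x : g} : x ∈ eigSub k g σ c ↔ σ x = c • x :=
  Module.End.mem_eigenspace_iff

theorem mem_q11 {σ₁ σ₂ : g ≃ₗ⁅k⁆ g} {x : g} :
    x ∈ qSpace k g σ₁ σ₂ true true ↔ σ₁ x = -x ∧ σ₂ x = -x := by
  simp [qSpace, mem_eig]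

theorem mem_q01 {σ₁ σ₂ : g ≃ₗ⁅k⁆ g} {x : g} :
    x ∈ qSpace k g σ₁ σ₂ false true ↔ σ₁ x = x ∧ σ₂ x = -x := by
  simp [qSpace, mem_eig]

theorem sigma_ss (σ : g ≃ₗ⁅k⁆ g) {x s n : g} (hx : σ x = -x) (hsn : x = s + n)
    (hs : (ad k g s).IsSemisimple) (hn : IsNilpotent (ad k g n)) (hc : ⁅s, n⁆ = 0) :
    σ s = - s := by
  have e1 := LieAlgebra.conj_ad_apply (R := k) σ s
  have e2 := LieAlgebra.conj_ad_apply (R := k) σ n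
  have hs' : (ad k g (σ s)).IsSemisimple := by
    rw [← LinearEquiv.isSemisimple_iff (ad k g s) (ad k g (σ s)) σ.toLinearEquiv]
    · exact hs
    · ext y; exact LieEquiv.map_lie σ s y
  have hn' : IsNilpotent (ad k g (σ n)) := by
    obtain ⟨N, hN⟩ := hn
    refine ⟨N, ?_⟩
    have key (j : ℕ) (y : g) : ((ad k g (σ n)) ^ j) (σ y) = σ (((ad k g n) ^ j) y) := by
      induction j with
      | zero => simp
      | succ j ih =>
        rw [pow_succ', pow_succ', Module.End.mul_apply, Module.End.mul_apply, ih, ad_apply,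
          ad_apply, LieEquiv.map_lie]
    ext y
    have := key N (σ.symm y)
    rw [LieEquiv.apply_symm_apply] at this
    rw [this, hN]
    simp
  have hcn : ⁅n, s⁆ = 0 := by rw [← lie_skew, hc, neg_zero]
  have hc' : Commute (ad k g (σ n)) (ad k g (σ s)) := by
    apply ad_comm; rw [← LieEquiv.map_lie, hcn]; simp
  have hcm : Commute (-(ad k g n)) (-(ad k g s)) := by
    have := ad_comm (k := k) hcn
    exact this.neg_left.neg_right
  have := (Module.End.isNilpotent_isSemisimple_unique hn' hs' hn.neg
    (Module.End.isSemisimple_neg.mpr hs) hc' hcm (by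
      rw [← map_add, ← map_add σ, add_comm n s, ← hsn, hx, ← neg_add, ← map_add, ← map_neg,
        hsn, add_comm])).2
  have h0 : ad k g (σ s + s) = 0 := by rw [map_add, this]; simp
  exact eq_neg_of_add_eq_zero_left (adk_inj h0)

theorem kf_sigma (σ : g ≃ₗ⁅k⁆ g) (hσ : IsInvolution k g σ) (x y : g) :
    killingForm k g x (σ y) = killingForm k g (σ x) y := by
  rw [← LieAlgebra.killingForm_of_equiv_apply σ x (σ y), hσ]

theorem kf_nd {x : g} (h : ∀ y, killingForm k g x y = 0) : x = 0 :=
  (LieAlgebra.IsKilling.killingForm_nondegenerate k g).1 x h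

theorem kf_comm (x y : g) : killingForm k g x y = killingForm k g y x :=
  LieModule.traceForm_comm k g g x y

theorem kf_inv (x y z : g) : killingForm k g ⁅x, y⁆ z = killingForm k g x ⁅y, z⁆ :=
  LieModule.traceForm_apply_lie_apply k g g x y z

theorem kf_nilp {n s : g} (hn : IsNilpotent (ad k g n)) (h : ⁅n, s⁆ = 0) :
    killingForm k g n s = 0 := by
  rw [killingForm_apply_apply]
  exact (LinearMap.isNilpotent_trace_of_isNilpotent
    ((ad_comm h).isNilpotent_mul_right hn)).eq_zero

theorem comm_adjoin {x y z : g} (h : ad k g y ∈ Algebra.adjoin k {ad k g x}) (hz : ⁅x, z⁆ = 0) :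
    ⁅y, z⁆ = 0 := by
  apply comm_of_ad (k := k)
  exact (Algebra.commute_of_mem_adjoin_singleton_of_commute h (ad_comm hz).symm).symm

theorem nondeg_aux {σ₁ σ₂ : g ≃ₗ⁅k⁆ g} (hcomm : CommutingInvolutions k g σ₁ σ₂)
    {c : Submodule k g} (hc : c ≤ qSpace k g σ₁ σ₂ true true) (hss : ∀ x ∈ c, IsSSElt k g x)
    (hcm : ∀ x ∈ c, ∀ y ∈ c, ⁅x, y⁆ = 0) {z : g} (hz : z ∈ qSpace k g σ₁ σ₂ true true)
    (hzc : ∀ y ∈ c, ⁅y, z⁆ = 0)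
    (h : ∀ w ∈ qSpace k g σ₁ σ₂ true true, (∀ y ∈ c, ⁅y, w⁆ = 0) → killingForm k g z w = 0) :
    z = 0 := by
  obtain ⟨x, hx, hgen⟩ := gen_aux c hss hcm
  obtain ⟨h1, h2, h12⟩ := hcomm
  rw [mem_q11] at hz
  have hxm := mem_q11.mp (hc hx)
  apply kf_nd (k := k)
  intro v
  obtain ⟨w, u, hw, rfl⟩ := split_aux (hss x hx) v
  have hσ (σ : g ≃ₗ⁅k⁆ g) (hσx : σ x = -x) {w : g} (hw : ⁅x, w⁆ = 0) : ⁅x, σ w⁆ = 0 := by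
    have := congrArg σ hw
    rw [LieEquiv.map_lie, hσx, neg_lie, map_zero, neg_eq_zero] at this
    exact this
  have e2 : killingForm k g z ⁅x, u⁆ = 0 := by
    rw [← kf_inv, ← lie_skew, hzc x hx]; simp
  have e1 := h (w - σ₁ w - σ₂ w + σ₁ (σ₂ w)) (by
      rw [mem_q11]
      constructor
      · simp only [map_add, map_sub, h1 _]; abel
      · simp only [map_add, map_sub, h2 _, ← h12]; abel) (by
      intro y hy
      apply comm_adjoin (hgen y hy)
      have a1 := hσ σ₁ hxm.1 hw
      have a2 := hσ σ₂ hxm.2 hw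
      have a3 := hσ σ₁ hxm.1 a2
      simp [lie_add, lie_sub, a1, a2, a3, hw])
  simp only [map_add, map_sub, kf_sigma σ₁ h1, kf_sigma σ₂ h2, hz.1, hz.2, map_neg, LinearMap.neg_apply] at e1
  rw [map_add, e2, add_zero]
  have : (4 : k) * killingForm k g z w = 0 := by rw [← e1]; ring
  simpa using this

theorem toral_adjoin {c : Submodule k g} (hss : ∀ x ∈ c, IsSSElt k g x)
    (hcm : ∀ x ∈ c, ∀ y ∈ c, ⁅x, y⁆ = 0) {s : g} (hs : IsSSElt k g s)
    (hsc : ∀ y ∈ c, ⁅y, s⁆ = 0) :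
    (∀ x ∈ c ⊔ Submodule.span k {s}, IsSSElt k g x) ∧
    (∀ x ∈ c ⊔ Submodule.span k {s}, ∀ y ∈ c ⊔ Submodule.span k {s}, ⁅x, y⁆ = 0) := by
  have hsc' : ∀ y ∈ c, ⁅s, y⁆ = 0 := fun y hy => by rw [← lie_skew, hsc y hy, neg_zero]
  constructor
  · intro x hx
    obtain ⟨y, hy, z, hz, rfl⟩ := Submodule.mem_sup.mp hx
    obtain ⟨t, rfl⟩ := Submodule.mem_span_singleton.mp hz
    unfold IsSSElt
    rw [map_add]
    refine Module.End.IsSemisimple.add_of_commute (ad_comm (by simp [hsc y hy])) (hss y hy) ?_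
    rw [map_smul]
    exact Module.End.IsSemisimple_smul t hs
  · intro x hx x' hx'
    obtain ⟨y, hy, z, hz, rfl⟩ := Submodule.mem_sup.mp hx
    obtain ⟨t, rfl⟩ := Submodule.mem_span_singleton.mp hz
    obtain ⟨y', hy', z, hz, rfl⟩ := Submodule.mem_sup.mp hx'
    obtain ⟨t', rfl⟩ := Submodule.mem_span_singleton.mp hz
    simp [hsc y hy, hsc' y' hy', hcm y hy y' hy']

theorem ssmax_aux {m c : Submodule k g} (hc : IsCartanSubspace k g m c) {s : g} (hsm : s ∈ m)
    (hs : IsSSElt k g s) (hsc : ∀ y ∈ c, ⁅y, s⁆ = 0) : s ∈ c := by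
  obtain ⟨h1, h2, h3, h4⟩ := hc
  obtain ⟨t1, t2⟩ := toral_adjoin h2 h3 hs hsc
  have := h4 (c ⊔ Submodule.span k {s}) (sup_le h1 (by simpa using hsm)) t1 t2 le_sup_left
  rw [← this]
  exact Submodule.mem_sup_right (Submodule.mem_span_singleton_self s)

theorem lemmaB {σ₁ σ₂ : g ≃ₗ⁅k⁆ g} (hcomm : CommutingInvolutions k g σ₁ σ₂)
    {c : Submodule k g} (hc : IsCartanSubspace k g (qSpace k g σ₁ σ₂ true true) c) :
    (∀ z ∈ qSpace k g σ₁ σ₂ true true, (∀ y ∈ c, ⁅y, z⁆ = 0) → z ∈ c) ∧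
    (∀ z ∈ c, (∀ y ∈ c, killingForm k g z y = 0) → z = 0) := by
  obtain ⟨h1, h2, h3, h4⟩ := id hc
  set m := qSpace k g σ₁ σ₂ true true with hm
  -- Jordan
  have hJ : ∀ z ∈ m, (∀ y ∈ c, ⁅y, z⁆ = 0) → ∃ s ∈ c, ∃ n ∈ m, (∀ y ∈ c, ⁅y, n⁆ = 0) ∧
      z = s + n ∧ IsNilpotent (ad k g n) := by
    intro z hz hzc
    obtain ⟨s, n, hsn, hs, hn, hsz⟩ := jordan_aux (k := k) z
    have hsz0 : ⁅s, z⁆ = 0 := comm_adjoin hsz (lie_self z)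
    have hsn0 : ⁅s, n⁆ = 0 := by rw [hsn, lie_add, lie_self, zero_add] at hsz0; exact hsz0
    have hz' := mem_q11.mp hz
    have hsm : s ∈ m := mem_q11.mpr ⟨sigma_ss σ₁ hz'.1 hsn hs hn hsn0, sigma_ss σ₂ hz'.2 hsn hs hn hsn0⟩
    have hsc : ∀ y ∈ c, ⁅y, s⁆ = 0 := fun y hy => by
      rw [← lie_skew, comm_adjoin hsz (z := y) (by rw [← lie_skew, hzc y hy, neg_zero]), neg_zero]
    have hn' : n = z - s := by rw [hsn]; abel
    refine ⟨s, ssmax_aux hc hsm hs hsc, n, hn' ▸ sub_mem hz hsm, fun y hy => ?_, hsn, hn⟩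
    rw [hn', lie_sub, hzc y hy, hsc y hy, sub_zero]
  have hnc : ∀ n ∈ m, (∀ y ∈ c, ⁅y, n⁆ = 0) → IsNilpotent (ad k g n) →
      ∀ y ∈ c, killingForm k g n y = 0 := fun n _ h hn y hy =>
    kf_nilp hn (by rw [← lie_skew, h y hy, neg_zero])
  have hND := fun z (hz : z ∈ m) hzc h => nondeg_aux hcomm h1 h2 h3 (z := z) hz hzc h
  have hB : ∀ z ∈ c, (∀ y ∈ c, killingForm k g z y = 0) → z = 0 := by
    intro z hz h
    refine hND z (h1 hz) (fun y hy => h3 y hy z hz) fun w hw hwc => ?_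
    obtain ⟨s, hs, n, hn, hnc', rfl, hnn⟩ := hJ w hw hwc
    rw [map_add, h s hs, kf_comm, hnc n hn hnc' hnn z hz, add_zero]
  -- elements of D
  have hD : ∀ z ∈ m, (∀ y ∈ c, ⁅y, z⁆ = 0) → (∀ y ∈ c, killingForm k g z y = 0) →
      killingForm k g z z = 0 := by
    intro z hz hzc h
    obtain ⟨s, hs, n, hn, hnc', rfl, hnn⟩ := hJ z hz hzc
    have : s = 0 := hB s hs fun y hy => by
      have := h y hy
      rw [map_add, LinearMap.add_apply, hnc n hn hnc' hnn y hy, add_zero] at this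
      exact this
    subst this
    rw [zero_add]
    exact kf_nilp hnn (lie_self n)
  have hD0 : ∀ z ∈ m, (∀ y ∈ c, ⁅y, z⁆ = 0) → (∀ y ∈ c, killingForm k g z y = 0) → z = 0 := by
    intro z hz hzc h
    refine hND z hz hzc fun w hw hwc => ?_
    obtain ⟨s, hs, n, hn, hnc', rfl, hnn⟩ := hJ w hw hwc
    rw [map_add, h s hs, zero_add]
    have a1 := hD z hz hzc h
    have a2 := hD n hn hnc' (hnc n hn hnc' hnn)
    have a3 := hD (z + n) (add_mem hz hn) (fun y hy => by rw [lie_add, hzc y hy, hnc' y hy, add_zero])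
      (fun y hy => by rw [map_add, LinearMap.add_apply, h y hy, hnc n hn hnc' hnn y hy, add_zero])
    simp only [map_add, LinearMap.add_apply, a1, a2, kf_comm n z] at a3
    have : (2 : k) * killingForm k g z n = 0 := by rw [← a3]; ring
    simpa using this
  refine ⟨fun z hz hzc => ?_, hB⟩
  obtain ⟨s, hs, n, hn, hnc', rfl, hnn⟩ := hJ z hz hzc
  rw [hD0 n hn hnc' (hnc n hn hnc' hnn), add_zero]
  exact hs

theorem dim_half {A : Module.End k g} (hA : ∀ u, A (A u) = 0 → A u = 0) {P Q : Submodule k g}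
    (hPQ : ∀ u ∈ P, A u ∈ Q) : finrank k (P.map A) ≤ finrank k (Q.map A) := by
  have h1 : (P.map A).map A ≤ Q.map A := Submodule.map_mono (by
    rintro _ ⟨u, hu, rfl⟩; exact hPQ u hu)
  have h2 : finrank k ((P.map A).map A) = finrank k (P.map A) := by
    apply LinearEquiv.finrank_eq
    symm
    refine LinearEquiv.ofBijective ((A.restrict (p := P.map A) (q := (P.map A).map A)
      (fun u hu => Submodule.mem_map_of_mem hu))) ⟨?_, ?_⟩
    · rw [← LinearMap.ker_eq_bot, LinearMap.ker_eq_bot']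
      rintro ⟨_, ⟨u, hu, rfl⟩⟩ h
      have := congrArg Subtype.val h
      apply Subtype.ext
      exact hA u (by simpa using this)
    · rintro ⟨_, ⟨u, hu, rfl⟩⟩
      exact ⟨⟨u, hu⟩, rfl⟩
  rw [← h2]
  exact Submodule.finrank_mono h1

theorem dim_ker (A : Module.End k g) (P : Submodule k g) :
    finrank k (P.map A) + finrank k (LinearMap.ker A ⊓ P : Submodule k g) = finrank k P := by
  have := LinearMap.finrank_range_add_finrank_ker (A.domRestrict P)
  rw [LinearMap.range_domRestrict] at this
  rw [← this]
  congr 1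
  have h2 : (LinearMap.ker (A.domRestrict P)).map P.subtype = LinearMap.ker A ⊓ P := by
    ext u
    simp [LinearMap.mem_ker, and_comm]
  rw [← h2, Submodule.finrank_map_subtype_eq]

theorem dim_formula {A : Module.End k g} (hA : ∀ u, A (A u) = 0 → A u = 0) {P Q : Submodule k g}
    (hPQ : ∀ u ∈ P, A u ∈ Q) (hQP : ∀ u ∈ Q, A u ∈ P) :
    finrank k (LinearMap.ker A ⊓ P : Submodule k g) + finrank k Q =
    finrank k (LinearMap.ker A ⊓ Q : Submodule k g) + finrank k P := by
  have h1 := dim_half hA hPQ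
  have h2 := dim_half hA hQP
  have h3 := dim_ker A P
  have h4 := dim_ker A Q
  omega

theorem exists_good {f f' : k → k} (hf : f ∈ Algebra.adjoin k {(id : k → k)})
    (hf' : f' ∈ Algebra.adjoin k {(id : k → k)}) {s s' : k} (h : f s ≠ 0) (h' : f' s' ≠ 0) :
    ∃ t, f t ≠ 0 ∧ f' t ≠ 0 := by
  rw [Algebra.adjoin_singleton_eq_range_aeval] at hf hf'
  obtain ⟨p, rfl⟩ := hf
  obtain ⟨p', rfl⟩ := hf'
  have key (p : Polynomial k) (t : k) : (Polynomial.aeval (id : k → k) p) t = p.eval t := by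
    have := Polynomial.aeval_algHom_apply (Pi.evalAlgHom k (fun _ : k => k) t) (id : k → k) p
    simpa [Polynomial.coe_aeval_eq_eval] using this.symm
  change (Polynomial.aeval (id : k → k) p) s ≠ 0 at h
  change (Polynomial.aeval (id : k → k) p') s' ≠ 0 at h'
  change ∃ t, (Polynomial.aeval (id : k → k) p) t ≠ 0 ∧ (Polynomial.aeval (id : k → k) p') t ≠ 0
  simp only [key] at *
  have hp : p * p' ≠ 0 := mul_ne_zero (by rintro rfl; simp at h) (by rintro rfl; simp at h')
  obtain ⟨t, ht⟩ := Polynomial.exists_eval_ne_zero_of_natDegree_lt_card (p * p') hp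
    (by exact lt_of_lt_of_le (Cardinal.natCast_lt_aleph0) (Cardinal.aleph0_le_mk k))
  rw [Polynomial.eval_mul] at ht
  exact ⟨t, left_ne_zero_of_mul ht, right_ne_zero_of_mul ht⟩

theorem const_mem (a : k) : (fun _ : k => a) ∈ Algebra.adjoin k {(id : k → k)} :=
  (Algebra.adjoin k {(id : k → k)}).algebraMap_mem a

theorem indep_generic {d : ℕ} (w : Fin d → k → g)
    (hw : ∀ j, ∀ φ : Module.Dual k g, (fun s => φ (w j s)) ∈ Algebra.adjoin k {(id : k → k)})
    (s₀ : k) (h0 : LinearIndependent k (fun j => w j s₀)) :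
    ∃ f ∈ Algebra.adjoin k {(id : k → k)}, f s₀ ≠ 0 ∧
      ∀ s, f s ≠ 0 → LinearIndependent k (fun j => w j s) := by
  obtain ⟨L, hL⟩ := LinearMap.exists_leftInverse_of_injective
    (Fintype.linearCombination k (fun j => w j s₀))
    (by
      rw [LinearMap.ker_eq_bot']
      intro m hm
      rw [Fintype.linearCombination_apply] at hm
      exact funext (Fintype.linearIndependent_iff.mp h0 m hm))
  have hL' (j : Fin d) : L (w j s₀) = Pi.single j 1 := by
    have := LinearMap.congr_fun hL (Pi.single j 1)
    simpa using this
  refine ⟨fun s => (Matrix.of fun j i => L (w j s) i).det, ?_, ?_, ?_⟩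
  · have : (fun s => (Matrix.of fun j i => L (w j s) i).det) =
        ∑ τ : Equiv.Perm (Fin d), (fun _ : k => ((Equiv.Perm.sign τ : ℤ) : k)) *
          ∏ i, fun s => L (w (τ i) s) i := by
      ext s
      simp [Matrix.det_apply', Finset.sum_apply, Finset.prod_apply]
    rw [this]
    refine sum_mem fun τ _ => mul_mem (const_mem _) (prod_mem fun i _ => ?_)
    exact hw (τ i) (LinearMap.proj i ∘ₗ L)
  · have : (Matrix.of fun j i => L (w j s₀) i) = 1 := by
      ext j i
      simp [hL', Matrix.one_apply, Pi.single_apply, eq_comm]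
    simp [this]
  · intro s hs
    have h1 : LinearIndependent k (Matrix.of fun j i => L (w j s) i).row :=
      Matrix.linearIndependent_rows_of_det_ne_zero hs
    exact LinearIndependent.of_comp L h1

/-- Polynomial families of endomorphisms. -/
def PolyEnd (F : k → Module.End k g) : Prop :=
  ∀ φ : Module.Dual k (Module.End k g), (fun s => φ (F s)) ∈ Algebra.adjoin k {(id : k → k)}

theorem PolyEnd.mul {F G : k → Module.End k g} (hF : PolyEnd F) (hG : PolyEnd G) :
    PolyEnd (fun s => F s * G s) := by
  intro φ
  let b := Module.finBasis k (Module.End k g)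
  have : (fun s => φ (F s * G s)) = ∑ i, ∑ j, (fun s => b.coord i (F s)) *
      (fun s => b.coord j (G s)) * (fun _ => φ (b i * b j)) := by
    ext s
    simp only [Finset.sum_apply, Pi.mul_apply, Basis.coord_apply]
    conv_lhs => rw [← b.sum_repr (F s), ← b.sum_repr (G s)]
    rw [Finset.sum_mul_sum]
    simp only [map_sum, smul_mul_assoc, mul_smul_comm, map_smul, smul_eq_mul]
    refine Finset.sum_congr rfl fun _ _ => Finset.sum_congr rfl fun _ _ => by ring
  rw [this]
  exact sum_mem fun i _ => sum_mem fun j _ =>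
    mul_mem (mul_mem (hF _) (hG _)) (const_mem _)

theorem PolyEnd.const (A : Module.End k g) : PolyEnd (fun _ : k => A) := fun _ => const_mem _

theorem PolyEnd.aeval {F : k → Module.End k g} (hF : PolyEnd F) (q : Polynomial k) :
    PolyEnd (fun s => Polynomial.aeval (F s) q) := by
  induction q using Polynomial.induction_on' with
  | add p q hp hq =>
    intro φ
    simp only [map_add]
    exact add_mem (hp φ) (hq φ)
  | monomial n a =>
    have hpow : PolyEnd (fun s => F s ^ n) := by
      induction n with
      | zero => simpa using PolyEnd.const 1
      | succ n ih => simpa [pow_succ] using ih.mul hF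
    simp only [Polynomial.aeval_monomial]
    exact (PolyEnd.const _).mul hpow

theorem PolyEnd.line (A C : Module.End k g) : PolyEnd (fun s : k => A + s • C) := by
  intro φ
  simp only [map_add, map_smul, smul_eq_mul]
  exact add_mem (const_mem _) (mul_mem (Algebra.self_mem_adjoin_singleton k _) (const_mem _))

theorem kf_dual (φ : Module.Dual k g) : ∃ z : g, ∀ y, killingForm k g z y = φ y := by
  have hinj : Function.Injective (killingForm k g) :=
    LinearMap.ker_eq_bot.mp (LieAlgebra.IsKilling.ker_killingForm_eq_bot k g)
  have := (LinearMap.injective_iff_surjective_of_finrank_eq_finrank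
    (f := (killingForm k g : g →ₗ[k] Module.Dual k g)) (by simp [Subspace.dual_finrank_eq])).mp hinj
  obtain ⟨z, hz⟩ := this φ
  exact ⟨z, fun y => by rw [hz]⟩

theorem card_le_of_li {d : ℕ} (W : Submodule k g) (v : Fin d → g) (hv : ∀ i, v i ∈ W)
    (li : LinearIndependent k v) : d ≤ finrank k W := by
  have h1 := finrank_span_eq_card li
  rw [Fintype.card_fin] at h1
  rw [← h1]
  apply Submodule.finrank_mono
  rw [Submodule.span_le]
  rintro _ ⟨i, rfl⟩
  exact hv i

theorem rank_bound (a : Submodule k g) (t : g)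
    (hgen : ∀ y ∈ a, ad k g y ∈ Algebra.adjoin k {ad k g t}) (h : g) :
    finrank k a ≤ finrank k (LinearMap.ker (ad k g h)) := by
  let x : k → g := fun s => t + s • (h - t)
  have hx : PolyEnd (fun s => ad k g (x s)) := by
    have := PolyEnd.line (ad k g t) (ad k g (h - t))
    simpa [x] using this
  -- gradients
  let y := Module.finBasis k a
  have hq (i) : ∃ q : Polynomial k, Polynomial.aeval (ad k g t) q = ad k g (y i) := by
    have := hgen (y i) (y i).2
    rw [Algebra.adjoin_singleton_eq_range_aeval] at this
    exact this
  choose q hq using hq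
  have hG (i) (s : k) : ∃ z : g, ∀ u, killingForm k g z u =
      LinearMap.trace k g (Polynomial.aeval (ad k g (x s)) (q i) * ad k g u) :=
    kf_dual (LinearMap.trace k g ∘ₗ LinearMap.mulLeft k (Polynomial.aeval (ad k g (x s)) (q i)) ∘ₗ
      (ad k g : g →ₗ[k] Module.End k g))
  choose G hG using hG
  have hG0 (i) : G i 0 = y i := by
    rw [← sub_eq_zero]
    apply kf_nd (k := k)
    intro u
    rw [map_sub, LinearMap.sub_apply, hG, sub_eq_zero]
    simp only [x, zero_smul, add_zero, hq]
    rw [killingForm_apply_apply]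
    rfl
  have hGk (i) (s : k) : G i s ∈ LinearMap.ker (ad k g (x s)) := by
    rw [LinearMap.mem_ker, ad_apply, ← lie_skew, neg_eq_zero]
    apply kf_nd (k := k)
    intro u
    rw [kf_inv, hG]
    set A := ad k g (x s) with hA
    have e : ad k g ⁅x s, u⁆ = A * ad k g u - ad k g u * A := by
      ext v; simp [A]
    have hc : Commute A (Polynomial.aeval A (q i)) :=
      Algebra.commute_of_mem_adjoin_self (Polynomial.aeval_mem_adjoin_singleton k A)
    rw [e, mul_sub, map_sub, ← mul_assoc, ← hc.eq, mul_assoc, LinearMap.trace_mul_comm,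
      mul_assoc, sub_self]
  obtain ⟨f, hf, hf0, hfi⟩ := indep_generic G (by
    intro i φ
    obtain ⟨z, hz⟩ := kf_dual φ
    have := ((hx.aeval (q i)).mul (PolyEnd.const (ad k g z))) (LinearMap.trace k g)
    simp only [← hG] at this
    simpa only [← hz, kf_comm z] using this) 0 (by
    simp only [hG0]
    exact y.linearIndependent.map' a.subtype a.ker_subtype)
  -- range
  let b := Module.finBasis k (LinearMap.range (ad k g h))
  have hv (j) : ∃ v, ad k g h v = b j := (b j).2
  choose v hv using hv
  obtain ⟨f', hf', hf'1, hf'i⟩ := indep_generic (fun j s => ad k g (x s) (v j)) (by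
    intro j φ
    exact hx (φ ∘ₗ LinearMap.applyₗ (v j))) 1 (by
    have : x 1 = h := by simp [x]
    simp only [this, hv]
    exact b.linearIndependent.map' (Submodule.subtype _) (Submodule.ker_subtype _))
  obtain ⟨s, hs, hs'⟩ := exists_good hf hf' hf0 hf'1
  have c1 : finrank k a ≤ finrank k (LinearMap.ker (ad k g (x s))) := by
    exact card_le_of_li _ _ (fun i => hGk i s) (hfi s hs)
  have c2 : finrank k (LinearMap.range (ad k g h)) ≤ finrank k (LinearMap.range (ad k g (x s))) := by
    exact card_le_of_li _ _ (fun j => LinearMap.mem_range_self _ _) (hf'i s hs')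
  have c3 := LinearMap.finrank_range_add_finrank_ker (ad k g (x s))
  have c4 := LinearMap.finrank_range_add_finrank_ker (ad k g h)
  omega

theorem exists_max (m c : Submodule k g) (hcm : c ≤ m) (h1 : ∀ x ∈ c, IsSSElt k g x)
    (h2 : ∀ x ∈ c, ∀ y ∈ c, ⁅x, y⁆ = 0) : ∃ a, c ≤ a ∧ IsCartanSubspace k g m a := by
  let S : Set (Submodule k g) := {a | c ≤ a ∧ a ≤ m ∧ (∀ x ∈ a, IsSSElt k g x) ∧
    ∀ x ∈ a, ∀ y ∈ a, ⁅x, y⁆ = 0}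
  obtain ⟨a, ⟨ha1, ha2, ha3, ha4⟩, hmax⟩ :=
    (wellFounded_gt (α := Submodule k g)).has_min S ⟨c, le_refl c, hcm, h1, h2⟩
  refine ⟨a, ha1, ha2, ha3, ha4, fun c' b1 b2 b3 b4 => ?_⟩
  by_contra hne
  exact hmax c' ⟨ha1.trans b4, b1, b2, b3⟩ (lt_of_le_of_ne b4 (Ne.symm hne))

theorem half_aux (k : Type*) [Field k] [CharZero k] {g : Type*} [LieRing g] [LieAlgebra k g]
    {v : g} (h : v = -v) : v = 0 := by
  have : (2 : k) • v = 0 := by rw [two_smul]; nth_rewrite 2 [h]; simp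
  exact (smul_eq_zero.mp this).resolve_left two_ne_zero

theorem csa_dim (σ : g ≃ₗ⁅k⁆ g) (H : LieSubalgebra k g) [H.IsCartanSubalgebra]
    (hH : H.toSubmodule ≤ eigSub k g σ (-1)) :
    ∃ h ∈ H, LinearMap.ker (ad k g h) = H.toSubmodule ∧ IsSSElt k g h ∧ σ h = -h := by
  have hcm : ∀ x ∈ H.toSubmodule, ∀ y ∈ H.toSubmodule, ⁅x, y⁆ = 0 := by
    intro x hx y hy
    have := trivial_lie_zero H H ⟨x, hx⟩ ⟨y, hy⟩
    exact congrArg Subtype.val this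
  have hss : ∀ x ∈ H.toSubmodule, IsSSElt k g x := fun x hx =>
    LieAlgebra.IsKilling.isSemisimple_ad_of_mem_isCartanSubalgebra hx
  obtain ⟨h, hh, hgen⟩ := gen_aux H.toSubmodule hss hcm
  refine ⟨h, hh, ?_, hss h hh, ?_⟩
  · ext u
    rw [LinearMap.mem_ker, ad_apply]
    constructor
    · intro hu
      have : u ∈ H.normalizer := by
        rw [H.mem_normalizer_iff]
        intro y hy
        have := comm_adjoin (hgen y hy) hu
        rw [← lie_skew, this, neg_zero]
        exact H.zero_mem
      rwa [LieSubalgebra.IsCartanSubalgebra.self_normalizing] at this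
    · intro hu
      exact hcm h hh u hu
  · have := mem_eig.mp (hH hh)
    simpa using this

theorem dim_eig (σ : g ≃ₗ⁅k⁆ g) {x : g} (hx : σ x = -x) (hs : IsSSElt k g x) :
    finrank k (LinearMap.ker (ad k g x) ⊓ eigSub k g σ (-1) : Submodule k g) +
      finrank k (eigSub k g σ 1) =
    finrank k (LinearMap.ker (ad k g x) ⊓ eigSub k g σ 1 : Submodule k g) +
      finrank k (eigSub k g σ (-1)) := by
  apply dim_formula
  · intro u hu
    exact disj_aux hs hu
  · intro u hu
    rw [mem_eig] at hu ⊢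
    rw [ad_apply, LieEquiv.map_lie, hx, hu]
    simp
  · intro u hu
    rw [mem_eig] at hu ⊢
    rw [ad_apply, LieEquiv.map_lie, hx, hu]
    simp

theorem eig_disj (σ : g ≃ₗ⁅k⁆ g) {x : g} (hx : σ x = -x) (hx' : σ x = x) : x = 0 :=
  half_aux k (hx'.symm.trans hx)

theorem key_zero (σ : g ≃ₗ⁅k⁆ g) (hσ : IsInvolution k g σ) (hmax : IsMaxRank k g σ)
    {a : Submodule k g} (ha : IsCartanSubspace k g (qSpace k g σ σ true true) a)
    {y : g} (hy : σ y = y) (hya : ∀ w ∈ a, ⁅w, y⁆ = 0) : y = 0 := by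
  obtain ⟨H, hHc, hH⟩ := hmax
  obtain ⟨h, hh, hker, hhs, hhσ⟩ := csa_dim σ H hH
  obtain ⟨t, ht, hgen⟩ := gen_aux a ha.2.1 ha.2.2.1
  have hB := (lemmaB ⟨hσ, hσ, fun _ => rfl⟩ ha).1
  have htσ : σ t = -t := (mem_q11.mp (ha.1 ht)).1
  have d1 := dim_eig σ hhσ hhs
  have d2 := dim_eig σ htσ (ha.2.1 t ht)
  have d3 := rank_bound a t hgen h
  have e1 : LinearMap.ker (ad k g h) ⊓ eigSub k g σ (-1) = LinearMap.ker (ad k g h) := by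
    rw [hker]; exact inf_eq_left.mpr hH
  have e2 : LinearMap.ker (ad k g h) ⊓ eigSub k g σ 1 = ⊥ := by
    rw [eq_bot_iff]
    rintro u ⟨hu1, hu2⟩
    rw [hker] at hu1
    have q1 := mem_eig.mp (hH hu1)
    have q2 := mem_eig.mp hu2
    exact eig_disj σ (by simpa using q1) (by simpa using q2)
  have e3 : LinearMap.ker (ad k g t) ⊓ eigSub k g σ (-1) = a := by
    ext u
    constructor
    · rintro ⟨hu1, hu2⟩
      have q2 : σ u = -u := by simpa using mem_eig.mp hu2
      exact hB u (mem_q11.mpr ⟨q2, q2⟩) fun y hy => comm_adjoin (hgen y hy) hu1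
    · intro hu
      exact ⟨ha.2.2.1 t ht u hu, mem_eig.mpr (by simpa using (mem_q11.mp (ha.1 hu)).1)⟩
  rw [e1, e2, finrank_bot] at d1
  rw [e3] at d2
  have d4 : finrank k (LinearMap.ker (ad k g t) ⊓ eigSub k g σ 1 : Submodule k g) = 0 := by omega
  rw [Submodule.finrank_eq_zero] at d4
  have : y ∈ LinearMap.ker (ad k g t) ⊓ eigSub k g σ 1 :=
    ⟨hya t ht, mem_eig.mpr (by simpa using hy)⟩
  rw [d4] at this
  exact this

theorem main_aux {σ₁ σ₂ : g ≃ₗ⁅k⁆ g} (hcomm : CommutingInvolutions k g σ₁ σ₂)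
    (hmax : IsMaxRank k g σ₁) {c : Submodule k g}
    (hc : IsCartanSubspace k g (qSpace k g σ₁ σ₂ true true) c)
    {y : g} (hy : y ∈ qSpace k g σ₁ σ₂ false true) (hyc : ∀ u ∈ c, ⁅u, y⁆ = 0) : y = 0 := by
  obtain ⟨hB1, hB2⟩ := lemmaB hcomm hc
  have hcσ := fun u hu => mem_q11.mp (hc.1 hu : u ∈ _)
  obtain ⟨a, hca, ha⟩ := exists_max (qSpace k g σ₁ σ₁ true true) c
    (fun u hu => mem_q11.mpr ⟨(hcσ u hu).1, (hcσ u hu).1⟩) hc.2.1 hc.2.2.1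
  obtain ⟨y1, y2⟩ := mem_q01.mp hy
  refine key_zero σ₁ hcomm.1 hmax ha y1 fun w hw => ?_
  have hw1 : σ₁ w = -w := (mem_q11.mp (ha.1 hw)).1
  have hcw : ∀ u ∈ c, ⁅u, w⁆ = 0 := fun u hu => ha.2.2.1 u (hca hu) w hw
  have hcw2 : ∀ u ∈ c, ⁅u, σ₂ w⁆ = 0 := fun u hu => by
    have := congrArg σ₂ (hcw u hu)
    rw [LieEquiv.map_lie, (hcσ u hu).2, neg_lie, map_zero, neg_eq_zero] at this
    exact this
  have hs2 : σ₂ (σ₂ w) = w := hcomm.2.1 w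
  have hs12 : σ₁ (σ₂ w) = - σ₂ w := by rw [hcomm.2.2, hw1, map_neg]
  -- the two components, doubled
  have p1 : w - σ₂ w ∈ c := by
    apply hB1
    · rw [mem_q11]
      rw [map_sub, map_sub, hw1, hs12, hs2]
      constructor <;> abel
    · intro u hu
      rw [lie_sub, hcw u hu, hcw2 u hu, sub_zero]
  have p2 : ⁅w - σ₂ w, y⁆ = 0 := hyc _ p1
  have p3c : ∀ u ∈ c, ⁅u, w + σ₂ w⁆ = 0 := fun u hu => by
    rw [lie_add, hcw u hu, hcw2 u hu, add_zero]
  have p4 : ⁅w + σ₂ w, y⁆ ∈ c := by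
    apply hB1
    · rw [mem_q11]
      simp only [LieEquiv.map_lie, map_add, hw1, hs12, hs2, y1, y2]
      constructor
      · rw [← neg_add, neg_lie]
      · rw [add_comm, lie_neg]
    · intro u hu
      rw [leibniz_lie, p3c u hu, hyc u hu, zero_lie, lie_zero, add_zero]
  have p5 : ⁅w + σ₂ w, y⁆ = 0 := by
    apply hB2 _ p4
    intro u hu
    rw [kf_inv, ← lie_skew, hyc u hu]
    simp
  have p6 : (2 : k) • ⁅w, y⁆ = 0 := by
    have : (2 : k) • ⁅w, y⁆ = ⁅w - σ₂ w, y⁆ + ⁅w + σ₂ w, y⁆ := by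
      rw [two_smul, ← add_lie, ← add_lie]; congr 1; abel
    rw [this, p2, p5, add_zero]
  exact (smul_eq_zero.mp p6).resolve_left two_ne_zero


end Aux

/-- If `σ₁` is of maximal rank, then any Cartan subspace of `g₁₁` is
also a Cartan subspace of `g₀₁ ⊕ g₁₁`, the `(-1)`-eigenspace of `σ₂`. -/
theorem cartanSubspace_g11_in_eigenspace_sigma2 (σ₁ σ₂ : g ≃ₗ⁅k⁆ g)
    (hcomm : CommutingInvolutions k g σ₁ σ₂)
    (hmax : IsMaxRank k g σ₁) :
    ∀ c : Submodule k g, IsCartanSubspace k g (qSpace k g σ₁ σ₂ true true) c →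
      IsCartanSubspace k g
        (qSpace k g σ₁ σ₂ false true ⊔ qSpace k g σ₁ σ₂ true true) c := by
  intro c hc
  refine ⟨hc.1.trans le_sup_right, hc.2.1, hc.2.2.1, fun c' h1 h2 h3 h4 => le_antisymm ?_ h4⟩
  intro y hy
  obtain ⟨y0, hy0, y1, hy1, rfl⟩ := Submodule.mem_sup.mp (h1 hy)
  obtain ⟨a1, a2⟩ := mem_q01.mp hy0
  obtain ⟨b1, b2⟩ := mem_q11.mp hy1
  have key : ∀ u ∈ c, ⁅u, y0⁆ = 0 ∧ ⁅u, y1⁆ = 0 := by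
    intro u hu
    have e1 : ⁅u, y0 + y1⁆ = 0 := h3 u (h4 hu) _ hy
    have e2 := congrArg σ₁ e1
    rw [LieEquiv.map_lie, map_add, a1, b1, (mem_q11.mp (hc.1 hu)).1] at e2
    simp only [lie_add, neg_lie, lie_neg, neg_neg, map_zero] at e1 e2
    have e3 : ⁅u, y1⁆ = ⁅u, y0⁆ := by rwa [neg_add_eq_zero, eq_comm] at e2
    rw [e3] at e1 ⊢
    have : ⁅u, y0⁆ = 0 := half_aux k (eq_neg_of_add_eq_zero_left e1)
    exact ⟨this, this⟩
  have z : y0 = 0 := main_aux hcomm hmax hc hy0 fun u hu => (key u hu).1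
  rw [z, zero_add]
  exact (lemmaB hcomm hc).1 y1 hy1 fun u hu => (key u hu).2
end
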